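/- (Satisfying agreement, main safety theorem.) Suppose every quorum-intersecting register set r has any two quorums in 𝒬 r intersecting. Let σ₀, …, σ_N be an execution in which every write-once step that writes a non-nil value satisfies both Rule 3 and Rule 4 at its pre-state. If a value v is decided in some register set r at σ_N and a value v' is decided in some register set r' at σ_N, then v = v'. -/

import Mathlib

/-- `Step σ σ' s r x`: a write-once step from `σ` to `σ'` writing `x` to the
previously unwritten register `r` on server `s`, leaving all else unchanged. -/
def Step {S V : Type*} (σ σ' : S → ℕ → Option (Option V))
    (s : S) (r : ℕ) (x : Option V) : Prop :=
  σ s r = none ∧ σ' s r = some x ∧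
    ∀ (s' : S) (r' : ℕ), ¬(s' = s ∧ r' = r) → σ' s' r' = σ s' r'

/-- `Possible CR σ r Q v`: the value `v` is a possible decision of the quorum
`Q` in register set `r` at state `σ`: every `s ∈ Q` has register `r` unwritten
or containing `v`, and moreover, if `r` is client-restricted (`CR r`), every
server with a non-nil value in register set `r` holds `v` there. -/
def Possible {S V : Type*} (CR : ℕ → Prop)
    (σ : S → ℕ → Option (Option V)) (r : ℕ) (Q : Set S) (v : V) : Prop :=
  (∀ s ∈ Q, σ s r = none ∨ σ s r = some (some v)) ∧
  (CR r → ∀ (s : S) (w : V), σ s r = some (some w) → w = v)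

/-- `Rule4 𝒬 CR σ r v`: a step writing the non-nil value `v` to register set
`r` satisfies Rule 4 at its pre-state `σ`: for every earlier register set
`r' < r`, every quorum `Q ∈ 𝒬 r'` and every value `v' ≠ v`, `v'` is not a
possible decision of `Q` in register set `r'` at `σ`. -/
def Rule4 {S V : Type*} (𝒬 : ℕ → Set (Set S)) (CR : ℕ → Prop)
    (σ : S → ℕ → Option (Option V)) (r : ℕ) (v : V) : Prop :=
  ∀ r' < r, ∀ Q ∈ 𝒬 r', ∀ v' : V, v' ≠ v → ¬ Possible CR σ r' Q v'

/-- `Decided 𝒬 σ r v`: the value `v` is decided in register set `r` at state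
`σ`, i.e. some quorum `Q ∈ 𝒬 r` has `σ s r = some (some v)` for all `s ∈ Q`. -/
def Decided {S V : Type*} (𝒬 : ℕ → Set (Set S))
    (σ : S → ℕ → Option (Option V)) (r : ℕ) (v : V) : Prop :=
  ∃ Q ∈ 𝒬 r, ∀ s ∈ Q, σ s r = some (some v)

/-- A write-once step never changes a register that is already written. -/
theorem Step.preserves {S V : Type*} {σ σ' : S → ℕ → Option (Option V)}
    {s : S} {r : ℕ} {x : Option V} (h : Step σ σ' s r x)
    {t : S} {i : ℕ} {y : Option V} (hy : σ t i = some y) : σ' t i = some y := by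
  obtain ⟨hnone, -, heq⟩ := h
  rw [heq t i ?_, hy]
  rintro ⟨rfl, rfl⟩
  simp [hnone] at hy

/-- A register that becomes written during a step is the one the step writes. -/
theorem Step.of_newly_written {S V : Type*} {σ σ' : S → ℕ → Option (Option V)}
    {s : S} {r : ℕ} {x : Option V} (h : Step σ σ' s r x)
    {t : S} {i : ℕ} {y : Option V} (hnone : σ t i = none) (hy : σ' t i = some y) :
    t = s ∧ i = r ∧ y = x := by
  by_cases hti : t = s ∧ i = r
  · obtain ⟨rfl, rfl⟩ := hti
    exact ⟨rfl, rfl, Option.some.inj (hy.symm.trans h.2.1)⟩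
  · rw [h.2.2 t i hti, hnone] at hy
    simp at hy

/-- Register contents persist along an execution. -/
theorem written_persists {S V : Type*} {N : ℕ} {σ : ℕ → S → ℕ → Option (Option V)}
    (hstep : ∀ k < N, ∃ (s : S) (r : ℕ) (x : Option V), Step (σ k) (σ (k + 1)) s r x)
    {k m : ℕ} (hkm : k ≤ m) (hm : m ≤ N) {s : S} {r : ℕ} {x : Option V}
    (hx : σ k s r = some x) : σ m s r = some x := by
  induction m, hkm using Nat.le_induction with
  | base => exact hx
  | succ m _ ih =>
    obtain ⟨_, _, _, h⟩ := hstep m hm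
    exact h.preserves (ih (Nat.le_of_succ_le hm))

/-- Every written register was written by an earlier step. -/
theorem exists_step_of_written {S V : Type*} {N : ℕ} {σ : ℕ → S → ℕ → Option (Option V)}
    (h0 : ∀ (s : S) (r : ℕ), σ 0 s r = none)
    (hstep : ∀ k < N, ∃ (s : S) (r : ℕ) (x : Option V), Step (σ k) (σ (k + 1)) s r x)
    {m : ℕ} (hm : m ≤ N) {s : S} {r : ℕ} {x : Option V} (hx : σ m s r = some x) :
    ∃ k < m, Step (σ k) (σ (k + 1)) s r x := by
  induction m with
  | zero => simp [h0] at hx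
  | succ m ih =>
    cases hσ : σ m s r with
    | none =>
      obtain ⟨_, _, _, h⟩ := hstep m hm
      obtain ⟨rfl, rfl, rfl⟩ := h.of_newly_written hσ hx
      exact ⟨m, Nat.lt_succ_self m, h⟩
    | some y =>
      have hy := written_persists hstep (Nat.le_succ m) hm hσ
      obtain rfl : y = x := Option.some.inj (hy.symm.trans hx)
      obtain ⟨k, hk, h⟩ := ih (Nat.le_of_succ_le hm) hσ
      exact ⟨k, Nat.lt_succ_of_lt hk, h⟩

/-- All non-nil values in a client-restricted register set coincide. -/
theorem client_restricted_unique {S V : Type*} {CR : ℕ → Prop} {N : ℕ}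
    {σ : ℕ → S → ℕ → Option (Option V)}
    (h0 : ∀ (s : S) (r : ℕ), σ 0 s r = none)
    (hstep : ∀ k < N, ∃ (s : S) (r : ℕ) (x : Option V), Step (σ k) (σ (k + 1)) s r x)
    (hrule3 : ∀ k < N, ∀ (s : S) (i : ℕ) (w : V),
      Step (σ k) (σ (k + 1)) s i (some w) → CR i →
      ∀ (s' : S) (w' : V), σ k s' i = some (some w') → w' = w)
    {r : ℕ} (hr : CR r) {s t : S} {v w : V}
    (hv : σ N s r = some (some v)) (hw : σ N t r = some (some w)) : v = w := by
  obtain ⟨k, hk, hs⟩ := exists_step_of_written h0 hstep le_rfl hv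
  obtain ⟨l, hl, ht⟩ := exists_step_of_written h0 hstep le_rfl hw
  rcases lt_trichotomy k l with hkl | rfl | hlk
  · exact hrule3 l hl t r w ht hr s v (written_persists hstep hkl hl.le hs.2.1)
  · exact Option.some.inj (ht.of_newly_written hs.1 hs.2.1).2.2
  · exact (hrule3 k hk s r v hs hr t w (written_persists hstep hlk hk.le ht.2.1)).symm

/-- A value held by a whole quorum at the end of an execution is a possible decision of that
quorum at every state of the execution. -/
theorem possible_of_quorum_holds {S V : Type*} {CR : ℕ → Prop} {N : ℕ}
    {σ : ℕ → S → ℕ → Option (Option V)}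
    (h0 : ∀ (s : S) (r : ℕ), σ 0 s r = none)
    (hstep : ∀ k < N, ∃ (s : S) (r : ℕ) (x : Option V), Step (σ k) (σ (k + 1)) s r x)
    (hrule3 : ∀ k < N, ∀ (s : S) (i : ℕ) (w : V),
      Step (σ k) (σ (k + 1)) s i (some w) → CR i →
      ∀ (s' : S) (w' : V), σ k s' i = some (some w') → w' = w)
    {r : ℕ} {Q : Set S} (hne : Q.Nonempty) {v : V}
    (hQ : ∀ s ∈ Q, σ N s r = some (some v)) {k : ℕ} (hk : k ≤ N) :
    Possible CR (σ k) r Q v := by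
  refine ⟨fun s hs => ?_, fun hr s w hw => ?_⟩
  · cases hσ : σ k s r with
    | none => exact Or.inl rfl
    | some x => exact Or.inr ((written_persists hstep hk le_rfl hσ).symm.trans (hQ s hs))
  · obtain ⟨t, ht⟩ := hne
    exact client_restricted_unique h0 hstep hrule3 hr
      (written_persists hstep hk le_rfl hw) (hQ t ht)

/-- Values decided in two different register sets agree. -/
theorem decided_eq_of_lt {S V : Type*} {𝒬 : ℕ → Set (Set S)} {CR : ℕ → Prop}
    (hQne : ∀ r : ℕ, ∀ Q ∈ 𝒬 r, Q.Nonempty) {N : ℕ}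
    {σ : ℕ → S → ℕ → Option (Option V)}
    (h0 : ∀ (s : S) (r : ℕ), σ 0 s r = none)
    (hstep : ∀ k < N, ∃ (s : S) (r : ℕ) (x : Option V), Step (σ k) (σ (k + 1)) s r x)
    (hrule3 : ∀ k < N, ∀ (s : S) (i : ℕ) (w : V),
      Step (σ k) (σ (k + 1)) s i (some w) → CR i →
      ∀ (s' : S) (w' : V), σ k s' i = some (some w') → w' = w)
    (hrule4 : ∀ k < N, ∀ (s : S) (i : ℕ) (w : V),
      Step (σ k) (σ (k + 1)) s i (some w) → Rule4 𝒬 CR (σ k) i w)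
    {r r' : ℕ} (hlt : r < r') {v v' : V}
    (hv : Decided 𝒬 (σ N) r v) (hv' : Decided 𝒬 (σ N) r' v') : v = v' := by
  obtain ⟨Q, hQ, hQv⟩ := hv
  obtain ⟨Q', hQ', hQv'⟩ := hv'
  obtain ⟨t, ht⟩ := hQne r' Q' hQ'
  obtain ⟨k, hk, h⟩ := exists_step_of_written h0 hstep le_rfl (hQv' t ht)
  by_contra hne
  exact hrule4 k hk t r' v' h r hlt Q hQ v hne
    (possible_of_quorum_holds h0 hstep hrule3 (hQne r Q hQ) hQv hk.le)

/-- **Satisfying agreement (main safety theorem).**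
Each register set is designated either quorum-intersecting (`¬ CR r`) or
client-restricted (`CR r`), and quorums are non-empty subsets of the servers.
Suppose every quorum-intersecting register set has any two of its quorums
intersecting. Let `σ 0, …, σ N` be an execution in which every write-once step
writing a non-nil value `w` to a register set `i` satisfies Rule 3 (if `i` is
client-restricted, every non-nil value in register set `i` at the pre-state
equals `w`) and Rule 4 at its pre-state. If `v` is decided in some register set
`r` at `σ N` and `v'` is decided in some register set `r'` at `σ N`, then
`v = v'`. -/
theorem agreement_safety
    {S V : Type*} [Fintype S]
    (𝒬 : ℕ → Set (Set S)) (CR : ℕ → Prop)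
    (hQI : ∀ r : ℕ, ¬ CR r → ∀ Q ∈ 𝒬 r, ∀ Q' ∈ 𝒬 r, (Q ∩ Q').Nonempty)
    (hQne : ∀ r : ℕ, ∀ Q ∈ 𝒬 r, Q.Nonempty)
    (N : ℕ) (σ : ℕ → S → ℕ → Option (Option V))
    (h0 : ∀ (s : S) (r : ℕ), σ 0 s r = none)
    (hstep : ∀ k < N, ∃ (s : S) (r : ℕ) (x : Option V), Step (σ k) (σ (k + 1)) s r x)
    (hrule3 : ∀ k < N, ∀ (s : S) (i : ℕ) (w : V),
      Step (σ k) (σ (k + 1)) s i (some w) → CR i →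
      ∀ (s' : S) (w' : V), σ k s' i = some (some w') → w' = w)
    (hrule4 : ∀ k < N, ∀ (s : S) (i : ℕ) (w : V),
      Step (σ k) (σ (k + 1)) s i (some w) → Rule4 𝒬 CR (σ k) i w)
    (r r' : ℕ) (v v' : V)
    (hv : Decided 𝒬 (σ N) r v) (hv' : Decided 𝒬 (σ N) r' v') :
    v = v' := by
  rcases lt_trichotomy r r' with hlt | rfl | hgt
  · exact decided_eq_of_lt hQne h0 hstep hrule3 hrule4 hlt hv hv'
  · obtain ⟨Q, hQ, hQv⟩ := hv
    obtain ⟨Q', hQ', hQv'⟩ := hv'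
    by_cases hr : CR r
    · obtain ⟨s, hs⟩ := hQne r Q hQ
      obtain ⟨t, ht⟩ := hQne r Q' hQ'
      exact client_restricted_unique h0 hstep hrule3 hr (hQv s hs) (hQv' t ht)
    · obtain ⟨s, hs, hs'⟩ := hQI r hr Q hQ Q' hQ'
      simpa using (hQv s hs).symm.trans (hQv' s hs')
  · exact (decided_eq_of_lt hQne h0 hstep hrule3 hrule4 hgt hv' hv).symm
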